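/- arXiv:1609.06630 — 3 statements merged into one kernel-verified Lean document; each statement's English description precedes it below -/
import Mathlib

section
/- Let p ≥ 1 be an integer and let k = 2p. For every positive integer λ, if there exists a function f : ℤ × ℤ → ℤ with 0 ≤ f(v) ≤ λ - 1 for all v, such that for all distinct u = (u₁,u₂) and v = (v₁,v₂) in ℤ × ℤ, |f(u) - f(v)| ≥ k + 1 - (|u₁ - v₁| + |u₂ - v₂|), then λ ≥ (2/3)·p·(p+1)·(2p+1) + 2. -/
/-- If the values of `f` at distinct points `u`, `v` of `s` differ by at least `K - w u - w v`, then
sorting `s` by `f` and telescoping bounds the spread of `f` on `s` from below. -/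
theorem exists_sum_add_le_sub {ι : Type*} [DecidableEq ι] (f w : ι → ℤ) (K : ℤ) (s : Finset ι)
    (hs : s.Nonempty) (h : ∀ u ∈ s, ∀ v ∈ s, u ≠ v → K - w u - w v ≤ |f u - f v|) :
    ∃ a ∈ s, ∃ b ∈ s, (∀ x ∈ s, f x ≤ f b) ∧ (1 < s.card → a ≠ b) ∧
      ∑ v ∈ s, (K - 2 * w v) - K + w a + w b ≤ f b - f a := by
  induction s using Finset.induction_on_max_value f with
  | empty => simp at hs
  | insert m s hm hmax ih =>
    rcases s.eq_empty_or_nonempty with rfl | hne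
    · exact ⟨m, by simp, m, by simp, by simp, by simp, by simp; linarith⟩
    obtain ⟨a, ha, b, hb, -, -, hab⟩ := ih hne fun u hu v hv =>
      h u (Finset.mem_insert_of_mem hu) v (Finset.mem_insert_of_mem hv)
    refine ⟨a, Finset.mem_insert_of_mem ha, m, Finset.mem_insert_self m s, ?_,
      fun _ ham => hm (ham ▸ ha), ?_⟩
    · simpa using hmax
    · have hmb := h m (Finset.mem_insert_self m s) b (Finset.mem_insert_of_mem hb)
        fun hmb => hm (hmb ▸ hb)
      rw [abs_of_nonneg (sub_nonneg.2 (hmax b hb))] at hmb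
      rw [Finset.sum_insert hm]
      linarith

/-- The closed Manhattan ball of radius `n` around the origin of `ℤ × ℤ`. -/
noncomputable def manhattanBall (n : ℕ) : Finset (ℤ × ℤ) :=
  (Finset.Icc (-n : ℤ) n ×ˢ Finset.Icc (-n : ℤ) n).filter fun v => |v.1| + |v.2| ≤ n

theorem mem_manhattanBall {n : ℕ} {v : ℤ × ℤ} : v ∈ manhattanBall n ↔ |v.1| + |v.2| ≤ n := by
  simp only [manhattanBall, Finset.mem_filter, Finset.mem_product, Finset.mem_Icc, ← abs_le]
  have := abs_nonneg v.1
  have := abs_nonneg v.2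
  omega

theorem sum_Icc_sub_two_mul_abs (n : ℕ) :
    ∑ y ∈ Finset.Icc (-n : ℤ) n, (2 * (n : ℤ) + 1 - 2 * |y|) = 2 * (n : ℤ) ^ 2 + 2 * n + 1 := by
  have hrange (c : ℤ) (N : ℕ) :
      ∑ i ∈ Finset.range (N + 1), (c - 2 * (i : ℤ)) = (N + 1) * (c - N) := by
    induction N with
    | zero => simp
    | succ N ih => rw [Finset.sum_range_succ, ih]; push_cast; ring
  rw [Finset.sum_Icc_of_even_eq_range (fun y => by simp)]
  simp only [Nat.abs_cast, hrange]
  simp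
  ring

theorem sum_Icc_sub_abs (n : ℕ) :
    3 * ∑ x ∈ Finset.Icc (-n : ℤ) n, (2 * (n - |x|) ^ 2 + 2 * (n - |x|) + 1) =
      2 * (n : ℤ) * (n + 1) * (2 * n + 1) + 3 * (2 * n + 1) := by
  have hrange (c : ℤ) (N : ℕ) :
      3 * ∑ i ∈ Finset.range (N + 1), (2 * (c - (i : ℤ)) ^ 2 + 2 * (c - i) + 1) =
        (N + 1) * (3 * (2 * c ^ 2 + 2 * c + 1) - 3 * (2 * c + 1) * N + N * (2 * N + 1)) := by
    induction N with
    | zero => simp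
    | succ N ih => rw [Finset.sum_range_succ, mul_add, ih]; push_cast; ring
  rw [Finset.sum_Icc_of_even_eq_range (fun x => by simp), mul_sub, mul_smul_comm]
  simp only [Nat.abs_cast, hrange]
  simp
  ring

theorem sum_manhattanBall (n : ℕ) :
    3 * ∑ v ∈ manhattanBall n, (2 * (n : ℤ) + 1 - 2 * (|v.1| + |v.2|)) =
      2 * (n : ℤ) * (n + 1) * (2 * n + 1) + 3 * (2 * n + 1) := by
  rw [← sum_Icc_sub_abs, Finset.sum_finset_product' (manhattanBall n) (Finset.Icc (-n : ℤ) n)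
    (fun x => Finset.Icc (-((n : ℤ) - |x|)) (n - |x|))
    (f := fun x y => 2 * (n : ℤ) + 1 - 2 * (|x| + |y|))]
  · congr 1
    refine Finset.sum_congr rfl fun x hx => ?_
    obtain ⟨m, hm⟩ := Int.eq_ofNat_of_zero_le (sub_nonneg.2 (abs_le.2 (Finset.mem_Icc.1 hx)))
    rw [hm, ← sum_Icc_sub_two_mul_abs]
    exact Finset.sum_congr rfl fun y _ => by linarith
  · intro v
    have := abs_nonneg v.2
    simp only [mem_manhattanBall, Finset.mem_Icc, ← abs_le]
    omega


/-- Lower bound on the `L(k, k-1, …, 2, 1)`-labeling number of the square grid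
for even `k = 2p`: any `λ`-labeling forces `λ ≥ (2/3)p(p+1)(2p+1) + 2`. -/
theorem lower_bound_even (p : ℤ) (hp : 1 ≤ p) (k : ℤ) (hk : k = 2 * p)
    (lam : ℤ) (hlam : 0 < lam)
    (f : ℤ × ℤ → ℤ)
    (hrange : ∀ v : ℤ × ℤ, 0 ≤ f v ∧ f v ≤ lam - 1)
    (hlab : ∀ u v : ℤ × ℤ, u ≠ v →
      k + 1 - (|u.1 - v.1| + |u.2 - v.2|) ≤ |f u - f v|) :
    2 * p * (p + 1) * (2 * p + 1) / 3 + 2 ≤ lam := by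
  subst hk
  lift p to ℕ using by omega
  have hmem0 : ((0, 0) : ℤ × ℤ) ∈ manhattanBall p := by simp [mem_manhattanBall]
  have hmem1 : ((1, 0) : ℤ × ℤ) ∈ manhattanBall p := by simpa [mem_manhattanBall] using hp
  obtain ⟨a, -, b, -, -, hab, hle⟩ := exists_sum_add_le_sub f (fun v => |v.1| + |v.2|)
    (2 * p + 1) (manhattanBall p) ⟨_, hmem0⟩ fun u _ v _ huv => by
      linarith [hlab u v huv, abs_sub u.1 v.1, abs_sub u.2 v.2]
  have hne : a ≠ b := hab (Finset.one_lt_card.2 ⟨_, hmem0, _, hmem1, by simp⟩)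
  have hpos : 1 ≤ |a.1| + |a.2| + (|b.1| + |b.2|) := by
    rw [Ne, Prod.ext_iff] at hne
    grind
  have hsum := sum_manhattanBall p
  have := (hrange b).2
  have := (hrange a).1
  omega
end

section
/- Let p ≥ 1 be an odd integer, let k = 2p + 1, and define L : ℤ × ℤ → ℤ by L(x,y) = ((2p+3)·x + (3p²+7p+5)·y) mod ((p+1)(3p²+5p+4)/2). Then for all distinct (x₁,y₁) and (x₂,y₂) in ℤ × ℤ, |L(x₁,y₁) - L(x₂,y₂)| ≥ k + 1 - (|x₁ - x₂| + |y₁ - y₂|). In particular, L is a λ-L(k, k-1, …, 2, 1)-labeling of the square grid with λ = (p+1)(3p²+5p+4)/2. -/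
/-- Hölder's inequality between the `ℓ¹` and `ℓ^∞` norms on `ℤ³`. -/
theorem abs_linear_form_le {M α β γ : ℤ} (hα : |α| ≤ M) (hβ : |β| ≤ M) (hγ : |γ| ≤ M)
    (x y z : ℤ) : |α * x + β * y + γ * z| ≤ M * (|x| + |y| + |z|) := by
  calc |α * x + β * y + γ * z| ≤ |α * x| + |β * y| + |γ * z| := abs_add_three _ _ _
    _ = |α| * |x| + |β| * |y| + |γ| * |z| := by simp only [abs_mul]
    _ ≤ M * |x| + M * |y| + M * |z| := by gcongr
    _ = M * (|x| + |y| + |z|) := by ring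

/-- A coordinate `i` given by `c * i = α * x + β * y + γ * z` is small when `(x, y, z)` is. -/
theorem abs_coordinate_lt {c i M N R α β γ x y z : ℤ} (hc : 0 < c)
    (hα : |α| ≤ M) (hβ : |β| ≤ M) (hγ : |γ| ≤ M) (hM : 0 < M)
    (hi : c * i = α * x + β * y + γ * z) (hR : |x| + |y| + |z| < R) (hN : M * R ≤ c * N) :
    |i| < N := by
  have h := abs_linear_form_le hα hβ hγ x y z
  rw [← hi, abs_mul, abs_of_pos hc] at h
  have h' : M * (|x| + |y| + |z|) < M * R := by gcongr
  exact lt_of_mul_lt_mul_left (h.trans_lt (h'.trans_le hN)) hc.le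

/-- The lattice spanned by `(-s, s, -2s)`, `(-3s, 1, 1 - s)` and `(1, 3s - 1, -s)` has no nonzero
vector of `ℓ¹` norm less than `4s` whose coordinates are at most `2`, `1` and `1`. -/
theorem eq_zero_of_small_coordinates {s i j l x y z : ℤ}
    (hi : |i| < 3) (hj : |j| < 2) (hl : |l| < 2)
    (hx : x = -s * i - 3 * s * j + l) (hy : y = s * i + j + (3 * s - 1) * l)
    (hz : z = -2 * s * i + (1 - s) * j - s * l) (h : |x| + |y| + |z| < 4 * s) :
    x = 0 ∧ y = 0 ∧ z = 0 := by
  have hx₁ := le_abs_self x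
  have hx₂ := neg_le_abs x
  have hy₁ := le_abs_self y
  have hy₂ := neg_le_abs y
  have hz₁ := le_abs_self z
  have hz₂ := neg_le_abs z
  generalize |x| = X at *
  generalize |y| = Y at *
  generalize |z| = Z at *
  rw [abs_lt] at hi hj hl
  obtain ⟨hi₁, hi₂⟩ := hi
  obtain ⟨hj₁, hj₂⟩ := hj
  obtain ⟨hl₁, hl₂⟩ := hl
  interval_cases i <;> interval_cases j <;> interval_cases l <;> omega

/-- The lattice `{(x, y, z) | z ≡ (4s+1)x + (12s²+2s+1)y mod 12s³-2s²+2s}` has `ℓ¹` minimum at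
least `4s`. -/
theorem eq_zero_of_abs_add_abs_add_abs_lt {s x y z t : ℤ} (hs : 1 ≤ s)
    (hz : z = (4 * s + 1) * x + (12 * s ^ 2 + 2 * s + 1) * y
      - (12 * s ^ 3 - 2 * s ^ 2 + 2 * s) * t)
    (h : |x| + |y| + |z| < 4 * s) : x = 0 ∧ y = 0 ∧ z = 0 := by
  have hc : 0 < 12 * s ^ 3 - 2 * s ^ 2 + 2 * s := by
    nlinarith [mul_pos (by linarith : 0 < s) (by nlinarith : 0 < 6 * s ^ 2 - s + 1)]
  have hi : |-3 * x - 9 * s * y + (9 * s ^ 2 - 3 * s + 1) * t| < 3 := by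
    refine abs_coordinate_lt (M := 9 * s ^ 2 - 3 * s + 1) (α := 3 * s ^ 2 - 5 * s + 1)
      (β := 1 - s - 3 * s ^ 2) (γ := -9 * s ^ 2 + 3 * s - 1) hc ?_ ?_ ?_ ?_ ?_ h ?_
    · rw [abs_le]; constructor <;> nlinarith
    · rw [abs_le]; constructor <;> nlinarith
    · rw [abs_le]; constructor <;> nlinarith
    · nlinarith
    · rw [hz]; ring
    · nlinarith
  have hj : |x + (3 * s + 1) * y - 3 * s ^ 2 * t| < 2 := by
    refine abs_coordinate_lt (M := 5 * s ^ 2) (α := -5 * s ^ 2 + 2 * s)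
      (β := s ^ 2 + 2 * s) (γ := 3 * s ^ 2) hc ?_ ?_ ?_ ?_ ?_ h ?_
    · rw [abs_le]; constructor <;> nlinarith
    · rw [abs_le]; constructor <;> nlinarith
    · rw [abs_le]; constructor <;> nlinarith
    · nlinarith
    · rw [hz]; ring
    · nlinarith [mul_nonneg (by linarith : 0 ≤ s) (sq_nonneg (s - 1))]
  have hl : |x + 3 * s * y - (3 * s ^ 2 - s) * t| < 2 := by
    refine abs_coordinate_lt (M := 5 * s ^ 2 + s) (α := 3 * s - s ^ 2)
      (β := 5 * s ^ 2 + s) (γ := 3 * s ^ 2 - s) hc ?_ ?_ ?_ ?_ ?_ h ?_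
    · rw [abs_le]; constructor <;> nlinarith
    · rw [abs_le]; constructor <;> nlinarith
    · rw [abs_le]; constructor <;> nlinarith
    · nlinarith
    · rw [hz]; ring
    · nlinarith [mul_nonneg (by linarith : 0 ≤ s) (sq_nonneg (s - 1))]
  exact eq_zero_of_small_coordinates hi hj hl (by ring) (by ring) (by rw [hz]; ring) h

/-- For odd `p ≥ 1` and `k = 2p+1`, the formula
`L(x,y) = ((2p+3)x + (3p²+7p+5)y) mod ((p+1)(3p²+5p+4)/2)` is a
`λ`-`L(k, k-1, …, 2, 1)`-labeling of the square grid with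
`λ = (p+1)(3p²+5p+4)/2`. -/
theorem formula_odd_k_odd_p (p : ℤ) (hp : 1 ≤ p) (hodd : Odd p)
    (k : ℤ) (hk : k = 2 * p + 1)
    (L : ℤ × ℤ → ℤ)
    (hL : ∀ v : ℤ × ℤ,
      L v = ((2 * p + 3) * v.1 + (3 * p ^ 2 + 7 * p + 5) * v.2) %
        ((p + 1) * (3 * p ^ 2 + 5 * p + 4) / 2)) :
    (∀ u v : ℤ × ℤ, u ≠ v →
      k + 1 - (|u.1 - v.1| + |u.2 - v.2|) ≤ |L u - L v|) ∧
    (∀ v : ℤ × ℤ, 0 ≤ L v ∧ L v ≤ (p + 1) * (3 * p ^ 2 + 5 * p + 4) / 2 - 1) := by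
  obtain ⟨m, rfl⟩ := hodd
  obtain ⟨s, rfl⟩ : ∃ s, m = s - 1 := ⟨m + 1, by ring⟩
  have hs : 1 ≤ s := by linarith
  have hc : (2 * (s - 1) + 1 + 1) * (3 * (2 * (s - 1) + 1) ^ 2 + 5 * (2 * (s - 1) + 1) + 4) / 2
      = 12 * s ^ 3 - 2 * s ^ 2 + 2 * s :=
    Int.ediv_eq_of_eq_mul_left two_ne_zero (by ring)
  rw [hc] at hL ⊢
  have hc₀ : 0 < 12 * s ^ 3 - 2 * s ^ 2 + 2 * s := by
    nlinarith [mul_pos (by linarith : 0 < s) (by nlinarith : 0 < 6 * s ^ 2 - s + 1)]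
  refine ⟨fun u v huv => ?_, fun v => ?_⟩
  · by_contra! h
    obtain ⟨h₁, h₂, -⟩ := eq_zero_of_abs_add_abs_add_abs_lt (x := u.1 - v.1) (y := u.2 - v.2)
      (z := L u - L v)
      (t := ((4 * s + 1) * u.1 + (12 * s ^ 2 + 2 * s + 1) * u.2)
          / (12 * s ^ 3 - 2 * s ^ 2 + 2 * s)
        - ((4 * s + 1) * v.1 + (12 * s ^ 2 + 2 * s + 1) * v.2)
          / (12 * s ^ 3 - 2 * s ^ 2 + 2 * s)) hs
      (by
        rw [hL, hL, Int.emod_def, Int.emod_def]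
        ring_nf)
      (by linarith)
    exact huv (Prod.ext (sub_eq_zero.mp h₁) (sub_eq_zero.mp h₂))
  · rw [hL]
    exact ⟨Int.emod_nonneg _ hc₀.ne', Int.le_sub_one_of_lt (Int.emod_lt_of_pos _ hc₀)⟩
end

section
/- Let p ≥ 0 be an even integer, let k = 2p + 1, and define L : ℤ × ℤ → ℤ by L(x,y) = ((2p+3)·x + (3p²+6p+3)·y) mod ((3p³+8p²+8p+4)/2). Then for all distinct (x₁,y₁) and (x₂,y₂) in ℤ × ℤ, |L(x₁,y₁) - L(x₂,y₂)| ≥ k + 1 - (|x₁ - x₂| + |y₁ - y₂|). In particular, L is a λ-L(k, k-1, …, 2, 1)-labeling of the square grid with λ = (3p³+8p²+8p+4)/2. -/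
/-- The left-hand side is a linear combination of coordinates of weighted size less than `2 n`,
so its quotient by `n` lies in `{-1, 0, 1}`. -/
lemma abs_le_one_of_mul_eq_linear_combination {n c s i a b d X Y W : ℤ}
    (h : n * i = a * X + b * Y + d * W)
    (ha : |a| ≤ c) (hb : |b| ≤ c) (hd : |d| ≤ c)
    (hs : |X| + |Y| + |W| ≤ s) (hn : 0 < n) (hc : c * s < 2 * n) : |i| ≤ 1 := by
  have hc0 : 0 ≤ c := (abs_nonneg a).trans ha
  have h1 : n * |i| ≤ c * s := by
    calc n * |i| = |a * X + b * Y + d * W| := by rw [← h, abs_mul, abs_of_pos hn]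
      _ ≤ |a| * |X| + |b| * |Y| + |d| * |W| := by
        rw [← abs_mul, ← abs_mul, ← abs_mul]
        exact abs_add_three _ _ _
      _ ≤ c * |X| + c * |Y| + c * |W| := by gcongr
      _ = c * (|X| + |Y| + |W|) := by ring
      _ ≤ c * s := by gcongr
  by_contra! h2
  nlinarith

/-- Nonzero vectors of the lattice spanned by `(2m, -(m+1), -(m+1))`, `(m+1, m, 2m+1)` and
`(m, -(2m+1), m+1)` have Manhattan norm at least `4m+2`. -/
lemma eq_zero_of_lattice_norm_le {m i j l X Y W : ℤ} (hm : 0 ≤ m)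
    (hX : X = 2 * m * i + (m + 1) * j + m * l)
    (hY : Y = -(m + 1) * i + m * j - (2 * m + 1) * l)
    (hW : W = -(m + 1) * i + (2 * m + 1) * j + (m + 1) * l)
    (hs : |X| + |Y| + |W| ≤ 4 * m + 1) : X = 0 ∧ Y = 0 := by
  have hm2 : 0 ≤ m ^ 2 := by positivity
  have hm3 : 0 ≤ m ^ 3 := by positivity
  have hn : 0 < 12 * m ^ 3 + 16 * m ^ 2 + 8 * m + 2 := by positivity
  have hi : |i| ≤ 1 := by
    refine abs_le_one_of_mul_eq_linear_combination (c := 5 * m ^ 2 + 5 * m + 1)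
      (a := 5 * m ^ 2 + 5 * m + 1) (b := m ^ 2 - m - 1) (d := -(3 * m ^ 2 + 3 * m + 1))
      ?_ ?_ ?_ ?_ hs hn ?_
    · rw [hX, hY, hW]; ring
    all_goals first | (rw [abs_le]; constructor <;> linarith) | nlinarith
  have hj : |j| ≤ 1 := by
    refine abs_le_one_of_mul_eq_linear_combination (c := 3 * m ^ 2 + 5 * m + 2)
      (a := 3 * m ^ 2 + 5 * m + 2) (b := 3 * m ^ 2 + 3 * m) (d := 3 * m ^ 2 + m)
      ?_ ?_ ?_ ?_ hs hn ?_
    · rw [hX, hY, hW]; ring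
    all_goals first | (rw [abs_le]; constructor <;> linarith) | nlinarith
  have hl : |l| ≤ 1 := by
    refine abs_le_one_of_mul_eq_linear_combination (c := 5 * m ^ 2 + 4 * m + 1)
      (a := -(m ^ 2 + 2 * m + 1)) (b := -(5 * m ^ 2 + 4 * m + 1)) (d := 3 * m ^ 2 + 2 * m + 1)
      ?_ ?_ ?_ ?_ hs hn ?_
    · rw [hX, hY, hW]; ring
    all_goals first | (rw [abs_le]; constructor <;> linarith) | nlinarith
  rw [abs_le] at hi hj hl
  obtain ⟨hi1, hi2⟩ := hi
  obtain ⟨hj1, hj2⟩ := hj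
  obtain ⟨hl1, hl2⟩ := hl
  have hX1 := le_abs_self X
  have hX2 := neg_le_abs X
  have hY1 := le_abs_self Y
  have hY2 := neg_le_abs Y
  have hW1 := le_abs_self W
  have hW2 := neg_le_abs W
  clear hn hm2 hm3
  interval_cases i <;> interval_cases j <;> interval_cases l <;> ring_nf at hX hY hW <;> omega


/-- For even `p ≥ 0` and `k = 2p+1`, the formula
`L(x,y) = ((2p+3)x + (3p²+6p+3)y) mod ((3p³+8p²+8p+4)/2)` is a
`λ`-`L(k, k-1, …, 2, 1)`-labeling of the square grid with
`λ = (3p³+8p²+8p+4)/2`. -/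
theorem formula_odd_k_even_p (p : ℤ) (hp : 0 ≤ p) (heven : Even p)
    (k : ℤ) (hk : k = 2 * p + 1)
    (L : ℤ × ℤ → ℤ)
    (hL : ∀ v : ℤ × ℤ,
      L v = ((2 * p + 3) * v.1 + (3 * p ^ 2 + 6 * p + 3) * v.2) %
        ((3 * p ^ 3 + 8 * p ^ 2 + 8 * p + 4) / 2)) :
    (∀ u v : ℤ × ℤ, u ≠ v →
      k + 1 - (|u.1 - v.1| + |u.2 - v.2|) ≤ |L u - L v|) ∧
    (∀ v : ℤ × ℤ, 0 ≤ L v ∧ L v ≤ (3 * p ^ 3 + 8 * p ^ 2 + 8 * p + 4) / 2 - 1) := by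
  obtain ⟨m, rfl⟩ := heven
  have hm : 0 ≤ m := by omega
  have hdiv : (3 * (m + m) ^ 3 + 8 * (m + m) ^ 2 + 8 * (m + m) + 4) / 2
      = 12 * m ^ 3 + 16 * m ^ 2 + 8 * m + 2 :=
    Int.ediv_eq_of_eq_mul_right two_ne_zero (by ring)
  rw [hdiv] at hL ⊢
  set n := 12 * m ^ 3 + 16 * m ^ 2 + 8 * m + 2 with hn
  have hn0 : 0 < n := by positivity
  constructor
  · intro u v huv
    by_contra! h
    obtain ⟨z, hz⟩ : ∃ z, L u - L v = (2 * (m + m) + 3) * (u.1 - v.1)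
        + (3 * (m + m) ^ 2 + 6 * (m + m) + 3) * (u.2 - v.2) - n * z := by
      rw [hL, hL, Int.emod_def, Int.emod_def]
      exact ⟨((2 * (m + m) + 3) * u.1 + (3 * (m + m) ^ 2 + 6 * (m + m) + 3) * u.2) / n
        - ((2 * (m + m) + 3) * v.1 + (3 * (m + m) ^ 2 + 6 * (m + m) + 3) * v.2) / n, by ring⟩
    obtain ⟨h1, h2⟩ := eq_zero_of_lattice_norm_le
      (i := -(u.1 - v.1) - (3 * m + 2) * (u.2 - v.2) + (3 * m ^ 2 + 3 * m + 1) * z)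
      (j := (u.1 - v.1) + 3 * m * (u.2 - v.2) - (3 * m ^ 2 + m) * z)
      (l := (u.1 - v.1) + (3 * m + 1) * (u.2 - v.2) - (3 * m ^ 2 + 2 * m + 1) * z)
      (X := u.1 - v.1) (Y := u.2 - v.2) (W := L u - L v) hm
      (by ring) (by ring) (by rw [hz, hn]; ring) (by linarith)
    exact huv (Prod.ext (sub_eq_zero.mp h1) (sub_eq_zero.mp h2))
  · intro v
    rw [hL]
    exact ⟨Int.emod_nonneg _ hn0.ne', Int.le_sub_one_of_lt (Int.emod_lt_of_pos _ hn0)⟩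
end
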